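/- (Lemma 4.3, 1D case.) Define η_c^{n,ℓ} = τ^{−1}(η^{n,ℓ+1} − Σ_{0≤m≤ℓ} c_{ℓm} η^{n,m}), η_d^{n,ℓ} = Σ_{0≤m≤ℓ} d_{ℓm} η^{n,m}, and the linear functional Z^{n,ℓ}(v) = ∫_Ω η_c^{n,ℓ} v dx − H(η_d^{n,ℓ}, v) − ∫_Ω ρ^{n,ℓ} v dx on V^k. Then there is a constant C, independent of h, τ, and n (depending on k, s, r, the Runge–Kutta coefficients, β, γ, and Sobolev norms of u), such that ‖Z^{n,ℓ}‖ ≤ C (h^{k+1} + τ^r) for all 0 ≤ ℓ ≤ s−1. -/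

import Mathlib

open Polynomial Finset MeasureTheory

namespace OEDG

variable {N : ℕ}

/-- `pt` lists the nodes `x_{1/2} < x_{3/2} < … < x_{N+1/2}` of a partition of `Ω = [0,1]`. -/
def IsMesh (pt : Fin (N+1) → ℝ) : Prop :=
  pt 0 = 0 ∧ pt (Fin.last N) = 1 ∧ StrictMono pt

/-- Left endpoint of cell `j`. -/
def ptL (pt : Fin (N+1) → ℝ) (j : Fin N) : ℝ := pt j.castSucc

/-- Right endpoint of cell `j`. -/
def ptR (pt : Fin (N+1) → ℝ) (j : Fin N) : ℝ := pt j.succ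

/-- Length `h_j` of cell `j`. -/
def cellh (pt : Fin (N+1) → ℝ) (j : Fin N) : ℝ := ptR pt j - ptL pt j

/-- Maximal mesh size `h`. -/
noncomputable def meshSize (pt : Fin (N+1) → ℝ) : ℝ := ⨆ j : Fin N, cellh pt j

/-- Quasi-uniformity of the partition: `h ≤ γ h_j` for all `j`. -/
def QuasiUniform (pt : Fin (N+1) → ℝ) (γ : ℝ) : Prop :=
  ∀ j : Fin N, meshSize pt ≤ γ * cellh pt j

/-- Membership in `V^k`: every cell polynomial has degree at most `k`. -/
def MemVk (k : ℕ) (u : Fin N → Polynomial ℝ) : Prop :=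
  ∀ j, (u j).natDegree ≤ k

/-- Cellwise `L²` inner product. -/
noncomputable def cip (pt : Fin (N+1) → ℝ) (j : Fin N) (p q : Polynomial ℝ) : ℝ :=
  ∫ x in (ptL pt j)..(ptR pt j), p.eval x * q.eval x

/-- Global `L²(Ω)` inner product of piecewise polynomials. -/
noncomputable def ip (pt : Fin (N+1) → ℝ) (u v : Fin N → Polynomial ℝ) : ℝ :=
  ∑ j : Fin N, cip pt j (u j) (v j)

/-- Cellwise `L²` norm. -/
noncomputable def cl2 (pt : Fin (N+1) → ℝ) (j : Fin N) (p : Polynomial ℝ) : ℝ :=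
  Real.sqrt (cip pt j p p)

/-- Global `L²(Ω)` norm of a piecewise polynomial. -/
noncomputable def l2 (pt : Fin (N+1) → ℝ) (u : Fin N → Polynomial ℝ) : ℝ :=
  Real.sqrt (ip pt u u)

/-- Average `avg(u) = (1/|Ω|) ∫_Ω u dx` (here `|Ω| = 1`). -/
noncomputable def avg (pt : Fin (N+1) → ℝ) (u : Fin N → Polynomial ℝ) : ℝ :=
  ∑ j : Fin N, ∫ x in (ptL pt j)..(ptR pt j), (u j).eval x

/-- `‖u - c‖_{L∞(Ω)}` for a piecewise polynomial `u` and a constant `c`. -/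
noncomputable def linfSub (pt : Fin (N+1) → ℝ) (u : Fin N → Polynomial ℝ) (c : ℝ) : ℝ :=
  ⨆ j : Fin N, sSup ((fun x => |(u j).eval x - c|) '' Set.Icc (ptL pt j) (ptR pt j))

/-- `m`-th derivative of a polynomial. -/
noncomputable def pderiv (m : ℕ) (p : Polynomial ℝ) : Polynomial ℝ :=
  (fun q : Polynomial ℝ => Polynomial.derivative q)^[m] p

/-- Jump `[∂_x^m u]_{j+1/2}` of the `m`-th derivative at the interface to the right of
cell `j`, with periodic identification of `x_{N+1/2}` with `x_{1/2}`. -/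
noncomputable def jumpD [NeZero N] (pt : Fin (N+1) → ℝ) (u : Fin N → Polynomial ℝ)
    (m : ℕ) (j : Fin N) : ℝ :=
  (pderiv m (u (j+1))).eval (pt (Fin.castSucc (j+1))) - (pderiv m (u j)).eval (pt j.succ)

/-- The scale-invariant damping coefficient `σ_j^m(u)` of the OEDG method. -/
noncomputable def sigma [NeZero N] (k : ℕ) (pt : Fin (N+1) → ℝ)
    (u : Fin N → Polynomial ℝ) (m : ℕ) (j : Fin N) : ℝ :=
  if ∀ i, u i = Polynomial.C (avg pt u) then 0
  else (2*(m:ℝ)+1) * (cellh pt j)^m / ((2*(k:ℝ)-1) * (Nat.factorial m)) *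
    ((|jumpD pt u m (j-1)| + |jumpD pt u m j|) / (2 * linfSub pt u (avg pt u)))

/-- Damping rate `δ_j^m = β_j σ_j^m(u) / h_j`. -/
noncomputable def dampRate [NeZero N] (k : ℕ) (pt : Fin (N+1) → ℝ) (β : Fin N → ℝ)
    (u : Fin N → Polynomial ℝ) (m : ℕ) (j : Fin N) : ℝ :=
  β j * sigma k pt u m j / cellh pt j

/-- `Pc j d` is the cellwise `L²(I_j)`-orthogonal projection onto `ℙ^d(I_j)`.
(The family `Pc` realizes the global projections `P^d` onto `V^d`.) -/
def IsCellProj (pt : Fin (N+1) → ℝ)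
    (Pc : Fin N → ℕ → Polynomial ℝ → Polynomial ℝ) : Prop :=
  ∀ (j : Fin N) (dd : ℕ) (p : Polynomial ℝ), (Pc j dd p).natDegree ≤ dd ∧
    ∀ q : Polynomial ℝ, q.natDegree ≤ dd → cip pt j (p - Pc j dd p) q = 0

/-- `w` solves the damping initial value problem with initial data `u`:
`d/dt̂ ∫_{I_j} u_σ v dx + ∑_{m=0}^k (β_j σ_j^m(u)/h_j) ∫_{I_j} (u_σ - P^{m-1} u_σ) v dx = 0`
for every `v ∈ ℙ^k(I_j)` and every `j`, with `u_σ(·,0) = u`.  (Note `m - 1` is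
truncated ℕ-subtraction, which realizes the convention `P^{-1} = P^0`.) -/
def IsDampingSol [NeZero N] (k : ℕ) (pt : Fin (N+1) → ℝ) (β : Fin N → ℝ)
    (Pc : Fin N → ℕ → Polynomial ℝ → Polynomial ℝ)
    (u : Fin N → Polynomial ℝ) (w : ℝ → Fin N → Polynomial ℝ) : Prop :=
  w 0 = u ∧ (∀ t j, (w t j).natDegree ≤ k) ∧
  ∀ (t : ℝ) (j : Fin N) (v : Polynomial ℝ), v.natDegree ≤ k →
    HasDerivAt (fun s => cip pt j (w s j) v)
      (-(∑ m ∈ Finset.range (k+1),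
        dampRate k pt β u m j * cip pt j (w t j - Pc j (m-1) (w t j)) v)) t

/-- `Fτ` is the OE (oscillation-eliminating) operator: for every `u ∈ V^k` the damping
initial value problem has a solution `w` and `Fτ u = w τ`. -/
def IsOEOp [NeZero N] (k : ℕ) (pt : Fin (N+1) → ℝ) (β : Fin N → ℝ)
    (Pc : Fin N → ℕ → Polynomial ℝ → Polynomial ℝ) (τ : ℝ)
    (Fτ : (Fin N → Polynomial ℝ) → (Fin N → Polynomial ℝ)) : Prop :=
  ∀ u, MemVk k u → ∃ w, IsDampingSol k pt β Pc u w ∧ Fτ u = w τ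

/-- Right-hand side of the weak form of the upwind DG operator for `u_t + β u_x = 0`:
`β ∫_{I_j} w v_x dx - β w(x_{j+1/2}^-) v(x_{j+1/2}^-) + β w(x_{j-1/2}^-) v(x_{j-1/2}^+)`. -/
noncomputable def dgRHS [NeZero N] (pt : Fin (N+1) → ℝ) (β : ℝ)
    (w : Fin N → Polynomial ℝ) (j : Fin N) (v : Polynomial ℝ) : ℝ :=
  β * (∫ x in (ptL pt j)..(ptR pt j), (w j).eval x * (Polynomial.derivative v).eval x)
  - β * (w j).eval (ptR pt j) * v.eval (ptR pt j)
  + β * (w (j-1)).eval (pt (j-1).succ) * v.eval (ptL pt j)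

/-- `L` is the upwind DG spatial operator on `V^k`. -/
def IsDGOp [NeZero N] (k : ℕ) (pt : Fin (N+1) → ℝ) (β : ℝ)
    (L : (Fin N → Polynomial ℝ) → (Fin N → Polynomial ℝ)) : Prop :=
  ∀ w, MemVk k w → MemVk k (L w) ∧
    ∀ (j : Fin N) (v : Polynomial ℝ), v.natDegree ≤ k →
      cip pt j (L w j) v = dgRHS pt β w j v

/-- The upwind DG bilinear form
`H(w,v) = β ∑_j ∫_{I_j} w v_x dx + β ∑_j w(x_{j+1/2}^-) [v]_{j+1/2}`. -/
noncomputable def Hform [NeZero N] (pt : Fin (N+1) → ℝ) (β : ℝ)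
    (w v : Fin N → Polynomial ℝ) : ℝ :=
  β * ∑ j : Fin N, (∫ x in (ptL pt j)..(ptR pt j),
      (w j).eval x * (Polynomial.derivative (v j)).eval x)
  + β * ∑ j : Fin N, (w j).eval (ptR pt j) * jumpD pt v 0 j

/-- The upwind DG bilinear form with piecewise-smooth first argument. -/
noncomputable def HformF [NeZero N] (pt : Fin (N+1) → ℝ) (β : ℝ)
    (w : Fin N → ℝ → ℝ) (v : Fin N → Polynomial ℝ) : ℝ :=
  β * ∑ j : Fin N, (∫ x in (ptL pt j)..(ptR pt j),
      w j x * (Polynomial.derivative (v j)).eval x)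
  + β * ∑ j : Fin N, w j (ptR pt j) * jumpD pt v 0 j

/-- `L²(Ω)` pairing of a piecewise-smooth function with a piecewise polynomial. -/
noncomputable def ipF (pt : Fin (N+1) → ℝ) (w : Fin N → ℝ → ℝ)
    (v : Fin N → Polynomial ℝ) : ℝ :=
  ∑ j : Fin N, ∫ x in (ptL pt j)..(ptR pt j), w j x * (v j).eval x

/-- One Runge–Kutta stage: `∑_{0≤m≤ℓ} (c_{ℓm} u_σ^{n,m} + τ d_{ℓm} L(u_σ^{n,m}))`. -/
noncomputable def rkStage [NeZero N] (c d : ℕ → ℕ → ℝ) (τ : ℝ)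
    (L : (Fin N → Polynomial ℝ) → (Fin N → Polynomial ℝ))
    (uσ : ℕ → Fin N → Polynomial ℝ) (ℓ : ℕ) : Fin N → Polynomial ℝ :=
  fun j => ∑ m ∈ Finset.range (ℓ+1),
    (Polynomial.C (c ℓ m) * uσ m j + Polynomial.C (τ * d ℓ m) * L (uσ m) j)

/-- One full OEDG time step from `u_σ^n = un`: the stages `u_h^{n,ℓ+1}` and
`u_σ^{n,ℓ+1} = F_τ u_h^{n,ℓ+1}`, `0 ≤ ℓ ≤ s-1`. -/
def IsOEDGStep [NeZero N] (s : ℕ) (c d : ℕ → ℕ → ℝ) (τ : ℝ)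
    (L Fτ : (Fin N → Polynomial ℝ) → (Fin N → Polynomial ℝ))
    (un : Fin N → Polynomial ℝ) (uh uσ : ℕ → Fin N → Polynomial ℝ) : Prop :=
  uσ 0 = un ∧ ∀ ℓ < s, uh (ℓ+1) = rkStage c d τ L uσ ℓ ∧ uσ (ℓ+1) = Fτ (uh (ℓ+1))

/-- The full OEDG evolution: `uσ n ℓ = u_σ^{n,ℓ}` and `uh n ℓ = u_h^{n,ℓ}`, starting from
`u_σ^0 = u0`, with `u_σ^{n+1} = u_σ^{n,s}`. -/
def IsOEDGEvol [NeZero N] (s : ℕ) (c d : ℕ → ℕ → ℝ) (τ : ℝ)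
    (L Fτ : (Fin N → Polynomial ℝ) → (Fin N → Polynomial ℝ))
    (u0 : Fin N → Polynomial ℝ) (uh uσ : ℕ → ℕ → Fin N → Polynomial ℝ) : Prop :=
  uσ 0 0 = u0 ∧ ∀ n, uσ (n+1) 0 = uσ n s ∧
    ∀ ℓ < s, uh n (ℓ+1) = rkStage c d τ L (uσ n) ℓ ∧ uσ n (ℓ+1) = Fτ (uh n (ℓ+1))

/-- `p` is the Gauss–Radau projection of `w` on `[a,b]` into `ℙ^k`:
`∫_a^b (w - p) q dx = 0` for all `q ∈ ℙ^{k-1}` and `p(b) = w(b)`. -/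
def IsGRProj (k : ℕ) (a b : ℝ) (w : ℝ → ℝ) (p : Polynomial ℝ) : Prop :=
  p.natDegree ≤ k ∧
  (∀ q : Polynomial ℝ, q.natDegree < k →
    (∫ x in a..b, (w x - p.eval x) * q.eval x) = 0) ∧
  p.eval b = w b

/-- `u = u(x,t)` is a smooth `1`-periodic exact solution of `u_t + β u_x = 0`. -/
def IsSmoothSolution (β : ℝ) (u : ℝ → ℝ → ℝ) : Prop :=
  ContDiff ℝ (⊤ : ℕ∞) (fun p : ℝ × ℝ => u p.1 p.2) ∧
  (∀ x t, u (x+1) t = u x t) ∧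
  (∀ x t, deriv (fun s => u x s) t + β * deriv (fun y => u y t) x = 0)

/-- Auxiliary table for the reference functions `U^{n,ℓ}`. -/
noncomputable def UrefUpTo (u : ℝ → ℝ → ℝ) (c d : ℕ → ℕ → ℝ) (β τ : ℝ) (n : ℕ) :
    ℕ → ℕ → ℝ → ℝ
  | 0 => fun _ => fun x => u x ((n:ℝ) * τ)
  | (ℓ+1) => fun i =>
      if i ≤ ℓ then UrefUpTo u c d β τ n ℓ i
      else fun x => ∑ m ∈ Finset.range (ℓ+1),
        (c ℓ m * UrefUpTo u c d β τ n ℓ m x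
          - τ * d ℓ m * β * deriv (UrefUpTo u c d β τ n ℓ m) x)

/-- Reference function `U^{n,ℓ}` (for `0 ≤ ℓ ≤ s-1`): `U^{n,0} = u(·, t^n)` and
`U^{n,ℓ+1} = ∑_{0≤m≤ℓ} (c_{ℓm} U^{n,m} - τ d_{ℓm} β ∂_x U^{n,m})`. -/
noncomputable def Uref (u : ℝ → ℝ → ℝ) (c d : ℕ → ℕ → ℝ) (β τ : ℝ) (n ℓ : ℕ) : ℝ → ℝ :=
  UrefUpTo u c d β τ n ℓ ℓ

/-- Reference function `U^{n,ℓ}` including the final stage `U^{n,s} := u(·, t^{n+1})`. -/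
noncomputable def UrefS (u : ℝ → ℝ → ℝ) (c d : ℕ → ℕ → ℝ) (β τ : ℝ) (s n ℓ : ℕ) : ℝ → ℝ :=
  if ℓ = s then fun x => u x (((n:ℝ)+1) * τ) else Uref u c d β τ n ℓ

/-- The Runge–Kutta residual `ρ^{n,s-1}`, defined so that
`U^{n,s} = ∑_{0≤m≤s-1} (c_{s-1,m} U^{n,m} - τ d_{s-1,m} β ∂_x U^{n,m}) + τ ρ^{n,s-1}`. -/
noncomputable def rkRes (u : ℝ → ℝ → ℝ) (c d : ℕ → ℕ → ℝ) (β τ : ℝ) (s n : ℕ) : ℝ → ℝ :=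
  fun x => (u x (((n:ℝ)+1) * τ) - ∑ m ∈ Finset.range s,
    (c (s-1) m * Uref u c d β τ n m x
      - τ * d (s-1) m * β * deriv (Uref u c d β τ n m) x)) / τ

/-- `L²(0,1)` norm of a function. -/
noncomputable def fl2 (f : ℝ → ℝ) : ℝ := Real.sqrt (∫ x in (0:ℝ)..1, (f x)^2)

/-- `L²(Ω)` distance between a piecewise polynomial and a function. -/
noncomputable def errL2 (pt : Fin (N+1) → ℝ) (w : Fin N → Polynomial ℝ) (f : ℝ → ℝ) : ℝ :=
  Real.sqrt (∑ j : Fin N, ∫ x in (ptL pt j)..(ptR pt j), ((w j).eval x - f x)^2)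


/-- Projection error `η^{n,m} = U^{n,m} - P* U^{n,m}` of the reference functions,
as a cellwise function on `Ω`. -/
noncomputable def etaRef {N : ℕ}
    (Pstar : (ℝ → ℝ) → Fin N → Polynomial ℝ)
    (u : ℝ → ℝ → ℝ) (c d : ℕ → ℕ → ℝ) (β τ : ℝ) (s n m : ℕ) :
    Fin N → ℝ → ℝ :=
  fun j x => UrefS u c d β τ s n m x - (Pstar (UrefS u c d β τ s n m) j).eval x

/-- `η_c^{n,ℓ} = τ⁻¹ (η^{n,ℓ+1} - ∑_{0≤m≤ℓ} c_{ℓm} η^{n,m})`. -/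
noncomputable def etaCcomb {N : ℕ}
    (Pstar : (ℝ → ℝ) → Fin N → Polynomial ℝ)
    (u : ℝ → ℝ → ℝ) (c d : ℕ → ℕ → ℝ) (β τ : ℝ) (s n ℓ : ℕ) :
    Fin N → ℝ → ℝ :=
  fun j x => (etaRef Pstar u c d β τ s n (ℓ+1) j x
    - ∑ m ∈ Finset.range (ℓ+1), c ℓ m * etaRef Pstar u c d β τ s n m j x) / τ

/-- `η_d^{n,ℓ} = ∑_{0≤m≤ℓ} d_{ℓm} η^{n,m}`. -/
noncomputable def etaDcomb {N : ℕ}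
    (Pstar : (ℝ → ℝ) → Fin N → Polynomial ℝ)
    (u : ℝ → ℝ → ℝ) (c d : ℕ → ℕ → ℝ) (β τ : ℝ) (s n ℓ : ℕ) :
    Fin N → ℝ → ℝ :=
  fun j x => ∑ m ∈ Finset.range (ℓ+1), d ℓ m * etaRef Pstar u c d β τ s n m j x

/-- `ρ^{n,ℓ}`: zero for `ℓ < s-1` and the Runge–Kutta residual for `ℓ = s-1`. -/
noncomputable def rhoRef (u : ℝ → ℝ → ℝ) (c d : ℕ → ℕ → ℝ) (β τ : ℝ) (s n ℓ : ℕ) :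
    ℝ → ℝ :=
  if ℓ = s - 1 then rkRes u c d β τ s n else fun _ => 0

/-- A family of smooth functions whose derivatives of each order are bounded uniformly in the
parameter and in space. -/
def UnifSmooth {ι : Type*} (f : ι → ℝ → ℝ) : Prop :=
  (∀ a, ContDiff ℝ (⊤ : ℕ∞) (f a)) ∧ ∀ i, ∃ M, ∀ a x, |iteratedDeriv i (f a) x| ≤ M

namespace UnifSmooth

variable {ι : Type*} {f g : ι → ℝ → ℝ}

theorem contDiffAt (hf : UnifSmooth f) (a : ι) (n : ℕ) (x : ℝ) : ContDiffAt ℝ n (f a) x :=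
  ((hf.1 a).of_le (by exact_mod_cast le_top)).contDiffAt

theorem deriv (hf : UnifSmooth f) : UnifSmooth fun a => deriv (f a) := by
  refine ⟨fun a => (contDiff_infty_iff_deriv.1 (hf.1 a)).2, fun i => ?_⟩
  obtain ⟨M, hM⟩ := hf.2 (i + 1)
  exact ⟨M, fun a x => by simpa only [iteratedDeriv_succ'] using hM a x⟩

theorem add (hf : UnifSmooth f) (hg : UnifSmooth g) :
    UnifSmooth fun a x => f a x + g a x := by
  refine ⟨fun a => (hf.1 a).add (hg.1 a), fun i => ?_⟩
  obtain ⟨M, hM⟩ := hf.2 i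
  obtain ⟨M', hM'⟩ := hg.2 i
  refine ⟨M + M', fun a x => ?_⟩
  rw [iteratedDeriv_fun_add (hf.contDiffAt a i x) (hg.contDiffAt a i x)]
  exact (abs_add_le _ _).trans (add_le_add (hM a x) (hM' a x))

theorem const_mul {b : ι → ℝ} {K : ℝ} (hb : ∀ a, |b a| ≤ K) (hf : UnifSmooth f) :
    UnifSmooth fun a x => b a * f a x := by
  refine ⟨fun a => contDiff_const.mul (hf.1 a), fun i => ?_⟩
  obtain ⟨M, hM⟩ := hf.2 i
  refine ⟨K * M, fun a x => ?_⟩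
  rw [iteratedDeriv_const_mul_field, abs_mul]
  exact mul_le_mul (hb a) (hM a x) (abs_nonneg _) ((abs_nonneg _).trans (hb a))

theorem zero : UnifSmooth fun (_ : ι) (_ : ℝ) => (0 : ℝ) :=
  ⟨fun _ => contDiff_const, fun i => ⟨0, fun a x => by simp⟩⟩

theorem sum {κ : Type*} {F : κ → ι → ℝ → ℝ} (S : Finset κ) (hF : ∀ m ∈ S, UnifSmooth (F m)) :
    UnifSmooth fun a x => ∑ m ∈ S, F m a x := by
  classical
  induction S using Finset.induction_on with
  | empty => simpa using zero
  | insert m S hm ih =>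
    simp only [Finset.sum_insert hm]
    exact (hF m (Finset.mem_insert_self m S)).add
      (ih fun i hi => hF i (Finset.mem_insert_of_mem hi))

end UnifSmooth

theorem exists_bound_iteratedDeriv_of_periodic {f : ℝ → ℝ} (hf : ContDiff ℝ (⊤ : ℕ∞) f)
    (hp : Function.Periodic f 1) (i : ℕ) : ∃ M, ∀ x, |iteratedDeriv i f x| ≤ M := by
  have hcont : Continuous (iteratedDeriv i f) :=
    hf.continuous_iteratedDeriv i (by exact_mod_cast le_top)
  have hper : Function.Periodic (iteratedDeriv i f) 1 := by
    intro x
    have h : (fun z => f (z + 1)) = f := funext hp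
    have h' := congrFun (iteratedDeriv_comp_add_const i f 1) x
    rw [h] at h'
    exact h'.symm
  obtain ⟨M, hM⟩ := isCompact_Icc.exists_bound_of_continuousOn (s := Set.Icc (0 : ℝ) 1)
    hcont.continuousOn
  refine ⟨M, fun x => ?_⟩
  obtain ⟨y, hy, hxy⟩ := hper.exists_mem_Ico₀ one_pos x
  rw [hxy]
  exact hM y (Set.Ico_subset_Icc_self hy)

theorem unifSmooth_shift {ι : Type*} {f : ℝ → ℝ} (hf : ContDiff ℝ (⊤ : ℕ∞) f)
    (hp : Function.Periodic f 1) (b : ι → ℝ) : UnifSmooth fun a x => f (x - b a) := by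
  refine ⟨fun a => hf.comp (contDiff_id.sub contDiff_const), fun i => ?_⟩
  obtain ⟨M, hM⟩ := exists_bound_iteratedDeriv_of_periodic hf hp i
  exact ⟨M, fun a x => by simpa only [iteratedDeriv_comp_sub_const] using hM _⟩

theorem unifSmooth_shift_diffQuot {ι : Type*} {f : ℝ → ℝ} (hf : ContDiff ℝ (⊤ : ℕ∞) f)
    (hp : Function.Periodic f 1) {b b' t : ι → ℝ} {K : ℝ} (ht : ∀ a, 0 < t a)
    (hb : ∀ a, |b' a - b a| ≤ K * t a) :
    UnifSmooth fun a x => (t a)⁻¹ * (f (x - b' a) + (-1) * f (x - b a)) := by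
  have h1 := unifSmooth_shift hf hp b
  have h2 := unifSmooth_shift hf hp b'
  refine ⟨fun a => contDiff_const.mul ((h2.1 a).add (contDiff_const.mul (h1.1 a))),
    fun i => ?_⟩
  obtain ⟨M, hM⟩ := exists_bound_iteratedDeriv_of_periodic hf hp (i + 1)
  have hM0 : 0 ≤ M := (abs_nonneg _).trans (hM 0)
  refine ⟨M * K, fun a x => ?_⟩
  rw [iteratedDeriv_const_mul_field, iteratedDeriv_fun_add (h2.contDiffAt a i x)
    (contDiffAt_const.mul (h1.contDiffAt a i x)), iteratedDeriv_const_mul_field,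
    iteratedDeriv_comp_sub_const, iteratedDeriv_comp_sub_const]
  have hd : Differentiable ℝ (iteratedDeriv i f) :=
    hf.differentiable_iteratedDeriv i (by exact_mod_cast WithTop.coe_lt_top i)
  have hmv := Convex.norm_image_sub_le_of_norm_deriv_le (𝕜 := ℝ) (f := iteratedDeriv i f)
    (s := Set.univ) (C := M) (fun x _ => hd x)
    (fun x _ => by rw [← iteratedDeriv_succ]; exact hM x) convex_univ
    (Set.mem_univ (x - b a)) (Set.mem_univ (x - b' a))
  rw [Real.norm_eq_abs, Real.norm_eq_abs] at hmv
  have e : x - b' a - (x - b a) = -(b' a - b a) := by ring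
  rw [e, abs_neg] at hmv
  rw [abs_mul, abs_of_pos (inv_pos.2 (ht a)), inv_mul_le_iff₀ (ht a), neg_one_mul,
    ← sub_eq_add_neg]
  calc _ ≤ M * |b' a - b a| := hmv
    _ ≤ M * (K * t a) := mul_le_mul_of_nonneg_left (hb a) hM0
    _ = t a * (M * K) := by ring

theorem IsSmoothSolution.contDiff_initial {β : ℝ} {u : ℝ → ℝ → ℝ} (hu : IsSmoothSolution β u) :
    ContDiff ℝ (⊤ : ℕ∞) fun x => u x 0 :=
  hu.1.comp (contDiff_id.prodMk contDiff_const)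

/-- Smooth solutions of the advection equation are constant along characteristics. -/
theorem IsSmoothSolution.eq_initial {β : ℝ} {u : ℝ → ℝ → ℝ} (hu : IsSmoothSolution β u)
    (x t : ℝ) : u x t = u (x - β * t) 0 := by
  obtain ⟨hs, -, hpde⟩ := hu
  have hD : Differentiable ℝ fun p : ℝ × ℝ => u p.1 p.2 := hs.differentiable (by simp)
  set y := x - β * t with hy
  have key : ∀ s, HasDerivAt (fun s => u (y + β * s) s) 0 s := by
    intro s
    have hF := (hD (y + β * s, s)).hasFDerivAt
    set A := fderiv ℝ (fun p : ℝ × ℝ => u p.1 p.2) (y + β * s, s)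
    have hc : HasDerivAt (fun s : ℝ => (y + β * s, s)) (β, (1 : ℝ)) s := by
      refine HasDerivAt.prodMk ?_ (hasDerivAt_id s)
      simpa using ((hasDerivAt_id s).const_mul β).const_add y
    have h1 : HasDerivAt (fun r : ℝ => (y + β * s, r)) ((0 : ℝ), (1 : ℝ)) s :=
      (hasDerivAt_const s _).prodMk (hasDerivAt_id s)
    have h2 : HasDerivAt (fun r : ℝ => (r, s)) ((1 : ℝ), (0 : ℝ)) (y + β * s) :=
      (hasDerivAt_id _).prodMk (hasDerivAt_const _ _)
    have e1 := (hF.comp_hasDerivAt s h1).deriv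
    have e2 := (hF.comp_hasDerivAt (y + β * s) h2).deriv
    have e3 : HasDerivAt (fun s => u (y + β * s) s) (A (β, 1)) s :=
      HasFDerivAt.comp_hasDerivAt (f := fun s : ℝ => (y + β * s, s)) s hF hc
    have hp := hpde (y + β * s) s
    simp only [Function.comp_def] at e1 e2
    rw [e1, e2] at hp
    have : A (β, 1) = 0 := by
      have : ((β, 1) : ℝ × ℝ) = (0, 1) + β • (1, 0) := by simp
      rw [this, map_add, map_smul, smul_eq_mul, hp]
    rwa [this] at e3
  have := is_const_of_deriv_eq_zero (fun s => (key s).differentiableAt)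
    (fun s => (key s).deriv) t 0
  simpa [hy] using this

theorem UrefUpTo_eq_Uref (u : ℝ → ℝ → ℝ) (c d : ℕ → ℕ → ℝ) (β τ : ℝ) (n : ℕ) {i ℓ : ℕ}
    (h : i ≤ ℓ) : UrefUpTo u c d β τ n ℓ i = Uref u c d β τ n i := by
  induction ℓ with
  | zero => rw [Nat.le_zero.1 h, Uref]
  | succ ℓ ih =>
    rcases Nat.lt_or_ge ℓ i with hi | hi
    · rw [show i = ℓ + 1 by omega, Uref]
    · rw [← ih hi]
      exact if_pos hi

theorem Uref_zero (u : ℝ → ℝ → ℝ) (c d : ℕ → ℕ → ℝ) (β τ : ℝ) (n : ℕ) :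
    Uref u c d β τ n 0 = fun x => u x ((n : ℝ) * τ) := rfl

theorem Uref_succ (u : ℝ → ℝ → ℝ) (c d : ℕ → ℕ → ℝ) (β τ : ℝ) (n ℓ : ℕ) :
    Uref u c d β τ n (ℓ + 1) = fun x => ∑ m ∈ Finset.range (ℓ + 1),
      (c ℓ m * Uref u c d β τ n m x - τ * d ℓ m * β * deriv (Uref u c d β τ n m) x) := by
  rw [Uref]
  refine (if_neg (by omega)).trans (funext fun x => ?_)
  refine Finset.sum_congr rfl fun m hm => ?_
  rw [UrefUpTo_eq_Uref u c d β τ n (Nat.lt_succ_iff.1 (Finset.mem_range.1 hm))]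

section Stages

variable {s : ℕ} {c d : ℕ → ℕ → ℝ} {β : ℝ} {u : ℝ → ℝ → ℝ}

theorem unifSmooth_Uref (c d : ℕ → ℕ → ℝ) (hu : IsSmoothSolution β u) (ℓ : ℕ) :
    UnifSmooth fun (a : Set.Ioc (0 : ℝ) 1 × ℕ) => Uref u c d β a.1 a.2 ℓ := by
  induction ℓ using Nat.strong_induction_on with
  | _ ℓ ih =>
    rcases ℓ with _ | ℓ
    · have := unifSmooth_shift hu.contDiff_initial (fun x => hu.2.1 x 0)
        (fun a : Set.Ioc (0 : ℝ) 1 × ℕ => β * (a.2 * a.1))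
      simpa only [Uref_zero, hu.eq_initial _ (_ * _)] using this
    · simp only [Uref_succ, sub_eq_add_neg, ← neg_mul]
      refine UnifSmooth.sum _ fun m hm => ?_
      have hU := ih m (by simpa using hm)
      refine (hU.const_mul (K := |c ℓ m|) fun _ => le_rfl).add
        (hU.deriv.const_mul (K := |d ℓ m * β|) fun a => ?_)
      have h1 : |(a.1 : ℝ)| ≤ 1 := by
        rw [abs_of_pos a.1.2.1]; exact a.1.2.2
      rw [mul_assoc, abs_mul, abs_neg]
      exact mul_le_of_le_one_left (abs_nonneg _) h1

/-- The stage increments `τ⁻¹ (U^{n,ℓ} - U^{n,0})` are smooth uniformly in `τ` and `n`. -/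
theorem unifSmooth_Uref_diffQuot (hc : ∀ ℓ < s, ∑ m ∈ Finset.range (ℓ + 1), c ℓ m = 1)
    (hu : IsSmoothSolution β u) {ℓ : ℕ} (hℓ : ℓ ≤ s) :
    UnifSmooth fun (a : Set.Ioc (0 : ℝ) 1 × ℕ) x =>
      (a.1 : ℝ)⁻¹ * (Uref u c d β a.1 a.2 ℓ x + (-1) * Uref u c d β a.1 a.2 0 x) := by
  induction ℓ using Nat.strong_induction_on with
  | _ ℓ ih =>
    rcases ℓ with _ | ℓ
    · simpa using UnifSmooth.zero
    · have key : UnifSmooth fun (a : Set.Ioc (0 : ℝ) 1 × ℕ) x =>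
          ∑ m ∈ Finset.range (ℓ + 1), (c ℓ m * ((a.1 : ℝ)⁻¹ *
            (Uref u c d β a.1 a.2 m x + (-1) * Uref u c d β a.1 a.2 0 x))
            + -(d ℓ m * β) * deriv (Uref u c d β a.1 a.2 m) x) := by
        refine UnifSmooth.sum _ fun m hm => ?_
        have hm' : m < ℓ + 1 := by simpa using hm
        exact ((ih m hm' (by omega)).const_mul (K := |c ℓ m|) fun _ => le_rfl).add
          ((unifSmooth_Uref c d hu m).deriv.const_mul (K := |-(d ℓ m * β)|) fun _ => le_rfl)
      convert key using 3 with a x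
      have hτ : (a.1 : ℝ) ≠ 0 := a.1.2.1.ne'
      have h0 : Uref u c d β a.1 a.2 0 x =
          ∑ m ∈ Finset.range (ℓ + 1), c ℓ m * Uref u c d β a.1 a.2 0 x := by
        rw [← Finset.sum_mul, hc ℓ (by omega), one_mul]
      conv_lhs =>
        rw [h0, Uref_succ, Finset.mul_sum, ← Finset.sum_add_distrib, Finset.mul_sum]
      refine Finset.sum_congr rfl fun m _ => ?_
      field_simp
      ring

/-- The combinations `τ⁻¹ (U^{n,ℓ+1} - ∑_m c_{ℓm} U^{n,m})` are smooth uniformly in `τ`, `n`. -/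
theorem unifSmooth_UrefS_comb (hc : ∀ ℓ < s, ∑ m ∈ Finset.range (ℓ + 1), c ℓ m = 1)
    (hu : IsSmoothSolution β u) {ℓ : ℕ} (hℓ : ℓ < s) :
    UnifSmooth fun (a : Set.Ioc (0 : ℝ) 1 × ℕ) x =>
      (a.1 : ℝ)⁻¹ * (UrefS u c d β a.1 s a.2 (ℓ + 1) x
        + (-1) * ∑ m ∈ Finset.range (ℓ + 1), c ℓ m * UrefS u c d β a.1 s a.2 m x) := by
  have hstart : UnifSmooth fun (a : Set.Ioc (0 : ℝ) 1 × ℕ) x => (a.1 : ℝ)⁻¹ *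
      (UrefS u c d β a.1 s a.2 (ℓ + 1) x + (-1) * Uref u c d β a.1 a.2 0 x) := by
    by_cases h : ℓ + 1 = s
    · have := unifSmooth_shift_diffQuot (K := |β|) hu.contDiff_initial (fun x => hu.2.1 x 0)
        (b := fun a : Set.Ioc (0 : ℝ) 1 × ℕ => β * (a.2 * a.1))
        (b' := fun a => β * ((a.2 + 1) * a.1)) (t := fun a => a.1) (fun a => a.1.2.1)
        (fun a => by
          rw [← mul_sub, abs_mul, ← sub_mul, add_sub_cancel_left, one_mul,
            abs_of_pos a.1.2.1])
      simpa only [UrefS, if_pos h, Uref_zero, hu.eq_initial _ (_ * _)] using this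
    · simpa only [UrefS, if_neg h] using unifSmooth_Uref_diffQuot hc hu (ℓ := ℓ + 1) hℓ
  have hsum : UnifSmooth fun (a : Set.Ioc (0 : ℝ) 1 × ℕ) x =>
      ∑ m ∈ Finset.range (ℓ + 1), -c ℓ m * ((a.1 : ℝ)⁻¹ *
        (Uref u c d β a.1 a.2 m x + (-1) * Uref u c d β a.1 a.2 0 x)) :=
    UnifSmooth.sum _ fun m hm =>
      (unifSmooth_Uref_diffQuot hc hu (by have := Finset.mem_range.1 hm; omega)).const_mul
        (K := |-c ℓ m|) fun _ => le_rfl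
  convert hstart.add hsum using 3 with a x
  have h0 : Uref u c d β a.1 a.2 0 x =
      ∑ m ∈ Finset.range (ℓ + 1), c ℓ m * Uref u c d β a.1 a.2 0 x := by
    rw [← Finset.sum_mul, hc ℓ hℓ, one_mul]
  have h1 : ∑ m ∈ Finset.range (ℓ + 1), -c ℓ m * ((a.1 : ℝ)⁻¹ *
        (Uref u c d β a.1 a.2 m x + (-1) * Uref u c d β a.1 a.2 0 x)) =
      (a.1 : ℝ)⁻¹ * (Uref u c d β a.1 a.2 0 x
        - ∑ m ∈ Finset.range (ℓ + 1), c ℓ m * UrefS u c d β a.1 s a.2 m x) := by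
    nth_rw 2 [h0]
    rw [← Finset.sum_sub_distrib, Finset.mul_sum]
    refine Finset.sum_congr rfl fun m hm => ?_
    rw [UrefS, if_neg (by have := Finset.mem_range.1 hm; omega)]
    ring
  rw [h1]
  ring

theorem continuous_UrefS (c d : ℕ → ℕ → ℝ) (hu : IsSmoothSolution β u) {τ : ℝ}
    (hτ : τ ∈ Set.Ioc (0 : ℝ) 1) (s n m : ℕ) : Continuous (UrefS u c d β τ s n m) := by
  rw [UrefS]
  split_ifs
  · exact hu.1.continuous.comp (by fun_prop : Continuous fun x : ℝ => (x, ((n : ℝ) + 1) * τ))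
  · exact ((unifSmooth_Uref c d hu m).1 (⟨τ, hτ⟩, n)).continuous

theorem continuous_rhoRef (c d : ℕ → ℕ → ℝ) (hu : IsSmoothSolution β u) {τ : ℝ}
    (hτ : τ ∈ Set.Ioc (0 : ℝ) 1) (s n ℓ : ℕ) : Continuous (rhoRef u c d β τ s n ℓ) := by
  rw [rhoRef]
  split_ifs
  · unfold rkRes
    have h1 : Continuous fun x => u x (((n : ℝ) + 1) * τ) :=
      hu.1.continuous.comp (by fun_prop : Continuous fun x : ℝ => (x, ((n : ℝ) + 1) * τ))
    refine (h1.sub (continuous_finsetSum _ fun m _ => ?_)).div_const _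
    exact (continuous_const.mul
      ((unifSmooth_Uref c d hu m).1 (⟨τ, hτ⟩, n)).continuous).sub
      (continuous_const.mul ((unifSmooth_Uref c d hu m).deriv.1 (⟨τ, hτ⟩, n)).continuous)
  · exact continuous_const

end Stages

theorem exists_derivative_eq {k : ℕ} (p : ℝ[X]) (hp : p.natDegree ≤ k) :
    ∃ q : ℝ[X], derivative q = p ∧ q.natDegree ≤ k + 1 := by
  refine ⟨∑ i ∈ Finset.range (k + 1), monomial (i + 1) (p.coeff i / (i + 1)), ?_, ?_⟩
  · conv_rhs => rw [p.as_sum_range' (k + 1) (Nat.lt_succ_of_le hp)]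
    rw [derivative_sum]
    refine Finset.sum_congr rfl fun i _ => ?_
    rw [derivative_monomial]
    have : (i : ℝ) + 1 ≠ 0 := by positivity
    push_cast
    rw [div_mul_cancel₀ _ this]
  · refine natDegree_sum_le_of_forall_le _ _ fun i hi => (natDegree_monomial_le _).trans ?_
    exact Nat.lt_succ_iff.1 (by simpa using hi)

/-- Taylor approximation at the right endpoint `b`, with remainder bound to the left of `b`. -/
theorem exists_taylor_left {G : ℝ → ℝ} (hG : ContDiff ℝ (⊤ : ℕ∞) G) (k : ℕ) {M : ℝ}
    (hM : ∀ x, |iteratedDeriv (k + 1) G x| ≤ M) (b : ℝ) :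
    ∃ T : ℝ[X], T.natDegree ≤ k ∧ T.eval b = G b ∧
      ∀ x ≤ b, |G x - T.eval x| ≤ M * (b - x) ^ (k + 1) := by
  induction k generalizing G with
  | zero =>
    refine ⟨C (G b), by simp, by simp, fun x hx => ?_⟩
    have h := Convex.norm_image_sub_le_of_norm_deriv_le (𝕜 := ℝ) (f := G)
      (s := Set.univ) (C := M) (fun x _ => hG.differentiable (by simp) x)
      (fun x _ => by simpa [iteratedDeriv_one] using hM x) convex_univ
      (Set.mem_univ b) (Set.mem_univ x)
    rw [Real.norm_eq_abs, Real.norm_eq_abs, abs_sub_comm x b,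
      abs_of_nonneg (sub_nonneg.2 hx)] at h
    simpa using h
  | succ k ih =>
    have hM0 : 0 ≤ M := (abs_nonneg _).trans (hM 0)
    obtain ⟨T', hdeg, -, hT'⟩ := ih (contDiff_infty_iff_deriv.1 hG).2
      (fun x => by simpa only [iteratedDeriv_succ'] using hM x)
    obtain ⟨q, hq, hqdeg⟩ := exists_derivative_eq T' hdeg
    refine ⟨q + C (G b - q.eval b), ?_, by simp, fun x hx => ?_⟩
    · exact (natDegree_add_le _ _).trans (by simpa using hqdeg)
    have hd : ∀ y, HasDerivAt (fun y => G y - q.eval y) (deriv G y - T'.eval y) y := fun y => by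
      have h := (hG.differentiable (by simp) y).hasDerivAt.sub (q.hasDerivAt y)
      rwa [hq] at h
    have h := Convex.norm_image_sub_le_of_norm_hasDerivWithin_le
      (s := Set.Icc x b) (C := M * (b - x) ^ (k + 1)) (fun y _ => (hd y).hasDerivWithinAt)
      (fun y hy => (hT' y hy.2).trans (by
        have h1 := sub_nonneg.2 hy.2
        have h2 := hy.1
        gcongr)) (convex_Icc x b)
      (Set.right_mem_Icc.2 hx) (Set.left_mem_Icc.2 hx)
    rw [Real.norm_eq_abs, Real.norm_eq_abs, abs_sub_comm x b,
      abs_of_nonneg (sub_nonneg.2 hx)] at h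
    rw [eval_add, eval_C]
    calc _ = |G x - q.eval x - (G b - q.eval b)| := by congr 1; ring
      _ ≤ _ := h
      _ = _ := by ring

namespace IsGRProj

variable {k : ℕ} {a b : ℝ} {w w' : ℝ → ℝ} {p p' : ℝ[X]}

theorem zero : IsGRProj k a b (fun _ => 0) 0 := by simp [IsGRProj]

theorem const_mul (r : ℝ) (h : IsGRProj k a b w p) :
    IsGRProj k a b (fun x => r * w x) (C r * p) := by
  refine ⟨(natDegree_C_mul_le _ _).trans h.1, fun q hq => ?_, by simp [h.2.2]⟩
  simp only [eval_mul, eval_C, ← mul_sub, mul_assoc, intervalIntegral.integral_const_mul,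
    h.2.1 q hq, mul_zero]

theorem add (hw : Continuous w) (hw' : Continuous w') (h : IsGRProj k a b w p)
    (h' : IsGRProj k a b w' p') : IsGRProj k a b (fun x => w x + w' x) (p + p') := by
  refine ⟨(natDegree_add_le _ _).trans (max_le h.1 h'.1), fun q hq => ?_,
    by simp [h.2.2, h'.2.2]⟩
  have i1 : IntervalIntegrable (fun x => (w x - p.eval x) * q.eval x) volume a b :=
    ((hw.sub p.continuous).mul q.continuous).intervalIntegrable _ _
  have i2 : IntervalIntegrable (fun x => (w' x - p'.eval x) * q.eval x) volume a b :=
    ((hw'.sub p'.continuous).mul q.continuous).intervalIntegrable _ _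
  have := intervalIntegral.integral_add i1 i2
  rw [h.2.1 q hq, h'.2.1 q hq, add_zero] at this
  rw [← this]
  congr 1
  funext x
  rw [eval_add]
  ring

theorem sum {κ : Type*} (S : Finset κ) {W : κ → ℝ → ℝ} {P : κ → ℝ[X]}
    (hW : ∀ i, Continuous (W i)) (h : ∀ i, IsGRProj k a b (W i) (P i)) :
    IsGRProj k a b (fun x => ∑ i ∈ S, W i x) (∑ i ∈ S, P i) := by
  classical
  induction S using Finset.induction_on with
  | empty => simpa using zero
  | insert m S hm ih =>
    simp only [Finset.sum_insert hm]
    exact add (hW m) (continuous_finsetSum _ fun i _ => hW i) (h m) ih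

theorem integral_mul_derivative (h : IsGRProj k a b w p) {v : ℝ[X]} (hv : v.natDegree ≤ k) :
    ∫ x in a..b, (w x - p.eval x) * (derivative v).eval x = 0 := by
  by_cases h0 : v.natDegree = 0
  · rw [natDegree_eq_zero.1 h0 |>.choose_spec.symm]
    simp
  · exact h.2.1 _ ((natDegree_derivative_lt h0).trans_le hv)

/-- Approximation property of the Gauss–Radau projection on one cell. -/
theorem integral_sq_sub_le (h : IsGRProj k a b w p) (hab : a ≤ b)
    (hw : ContDiff ℝ (⊤ : ℕ∞) w) {M : ℝ} (hM : ∀ x, |iteratedDeriv (k + 1) w x| ≤ M) :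
    ∫ x in a..b, (w x - p.eval x) ^ 2 ≤ 4 * M ^ 2 * (b - a) ^ (2 * (k + 1)) * (b - a) := by
  have hM0 : 0 ≤ M := (abs_nonneg _).trans (hM 0)
  have hwc := hw.continuous
  obtain ⟨T, hTdeg, hTb, hT⟩ := exists_taylor_left hw k hM b
  have hroot : (p - T).IsRoot b := by simp [IsRoot, h.2.2, hTb]
  obtain ⟨q, hq⟩ := dvd_iff_isRoot.2 hroot
  have hev : ∀ x, p.eval x - T.eval x = (x - b) * q.eval x := fun x => by
    rw [← eval_sub, hq]; simp
  have horth : ∫ x in a..b, (w x - p.eval x) * q.eval x = 0 := by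
    by_cases hq0 : q = 0
    · simp [hq0]
    · refine h.2.1 q ?_
      have h1 : (p - T).natDegree ≤ k := (natDegree_sub_le _ _).trans (max_le h.1 hTdeg)
      rw [hq, natDegree_mul (X_sub_C_ne_zero b) hq0, natDegree_X_sub_C] at h1
      omega
  -- Weighted bound for the quotient `q`, obtained by testing the orthogonality with `q`.
  have hpt : ∀ x ∈ Set.Icc a b, (b - x) * q.eval x ^ 2 ≤
      M ^ 2 * (b - a) ^ (2 * k + 1) + 2 * ((w x - p.eval x) * q.eval x) := by
    intro x hx
    have hbx : 0 ≤ b - x := sub_nonneg.2 hx.2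
    have he := hT x hx.2
    set e := w x - T.eval x with he_def
    have hwp : w x - p.eval x = e + (b - x) * q.eval x := by
      rw [he_def]; linear_combination -(hev x)
    have hmono : M ^ 2 * (b - x) ^ (2 * k + 1) ≤ M ^ 2 * (b - a) ^ (2 * k + 1) := by
      have := hx.1
      gcongr
    have h2 : -(2 * (e * q.eval x)) ≤ 2 * (M * (b - x) ^ (k + 1) * |q.eval x|) := by
      have h3 : |e * q.eval x| ≤ M * (b - x) ^ (k + 1) * |q.eval x| := by
        rw [abs_mul]; gcongr
      have := neg_abs_le (e * q.eval x)
      linarith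
    have h4 : 0 ≤ (b - x) * (M * (b - x) ^ k - |q.eval x|) ^ 2 := by positivity
    have h5 : (b - x) * (M * (b - x) ^ k - |q.eval x|) ^ 2 =
        M ^ 2 * (b - x) ^ (2 * k + 1) - 2 * (M * (b - x) ^ (k + 1) * |q.eval x|)
          + (b - x) * q.eval x ^ 2 := by
      rw [← sq_abs (q.eval x)]; ring
    rw [hwp]
    nlinarith
  have hqw : ∫ x in a..b, (b - x) * q.eval x ^ 2 ≤ M ^ 2 * (b - a) ^ (2 * k + 1) * (b - a) := by
    have hmono := intervalIntegral.integral_mono_on (μ := volume) hab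
      (Continuous.intervalIntegrable (by fun_prop) a b)
      (Continuous.intervalIntegrable (by fun_prop) a b) hpt
    rw [intervalIntegral.integral_add (Continuous.intervalIntegrable (by fun_prop) a b)
        (Continuous.intervalIntegrable (by fun_prop) a b),
      intervalIntegral.integral_const_mul 2, horth,
      intervalIntegral.integral_const, smul_eq_mul] at hmono
    linarith
  have hfin : ∀ x ∈ Set.Icc a b, (w x - p.eval x) ^ 2 ≤
      2 * (M ^ 2 * (b - a) ^ (2 * (k + 1))) + 2 * (b - a) * ((b - x) * q.eval x ^ 2) := by
    intro x hx
    have hbx : 0 ≤ b - x := sub_nonneg.2 hx.2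
    have he : |w x - T.eval x| ≤ M * (b - a) ^ (k + 1) := (hT x hx.2).trans (by
      have := hx.1
      gcongr)
    have he2 : (w x - T.eval x) ^ 2 ≤ M ^ 2 * (b - a) ^ (2 * (k + 1)) := by
      calc (w x - T.eval x) ^ 2 = |w x - T.eval x| ^ 2 := (sq_abs _).symm
        _ ≤ (M * (b - a) ^ (k + 1)) ^ 2 := by gcongr
        _ = _ := by ring
    have hwp : w x - p.eval x = (w x - T.eval x) + (b - x) * q.eval x := by
      linear_combination -(hev x)
    have h1 : ((b - x) * q.eval x) ^ 2 ≤ (b - a) * ((b - x) * q.eval x ^ 2) := by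
      have : 0 ≤ (b - x) * q.eval x ^ 2 := by positivity
      have := mul_le_mul_of_nonneg_right (sub_le_sub_left hx.1 b) this
      linarith
    rw [hwp]
    nlinarith [sq_nonneg (w x - T.eval x - (b - x) * q.eval x)]
  have hmono := intervalIntegral.integral_mono_on (μ := volume) hab
    (Continuous.intervalIntegrable (by fun_prop) a b)
    (Continuous.intervalIntegrable (by fun_prop) a b) hfin
  rw [intervalIntegral.integral_add (Continuous.intervalIntegrable (by fun_prop) a b)
      (Continuous.intervalIntegrable (by fun_prop) a b),
    intervalIntegral.integral_const_mul (2 * (b - a)),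
    intervalIntegral.integral_const, smul_eq_mul] at hmono
  have hba : 0 ≤ 2 * (b - a) := by linarith
  have := mul_le_mul_of_nonneg_left hqw hba
  calc _ ≤ _ := hmono
    _ ≤ (b - a) * (2 * (M ^ 2 * (b - a) ^ (2 * (k + 1))))
        + 2 * (b - a) * (M ^ 2 * (b - a) ^ (2 * k + 1) * (b - a)) := by linarith
    _ = _ := by ring

end IsGRProj

theorem IsMesh.ptL_lt_ptR {pt : Fin (N+1) → ℝ} (hpt : IsMesh pt) (j : Fin N) :
    ptL pt j < ptR pt j :=
  hpt.2.2 Fin.castSucc_lt_succ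

theorem cellh_le_meshSize (pt : Fin (N+1) → ℝ) (j : Fin N) : cellh pt j ≤ meshSize pt :=
  le_ciSup (Set.finite_range (cellh pt)).bddAbove j

theorem sum_sub_telescope (F : ℝ → ℝ) (pt : Fin (N+1) → ℝ) :
    ∑ j : Fin N, (F (ptR pt j) - F (ptL pt j)) = F (pt (Fin.last N)) - F (pt 0) := by
  have h1 := Fin.sum_univ_succ fun i => F (pt i)
  have h2 := Fin.sum_univ_castSucc fun i => F (pt i)
  simp only [ptR, ptL, Finset.sum_sub_distrib]
  linarith

theorem IsMesh.sum_cellh {pt : Fin (N+1) → ℝ} (hpt : IsMesh pt) : ∑ j, cellh pt j = 1 := by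
  have := sum_sub_telescope (fun x => x) pt
  rw [hpt.1, hpt.2.1, sub_zero] at this
  exact this

theorem IsMesh.sum_integral {pt : Fin (N+1) → ℝ} (hpt : IsMesh pt) {f : ℝ → ℝ}
    (hf : Continuous f) :
    ∑ j : Fin N, ∫ x in (ptL pt j)..(ptR pt j), f x = ∫ x in (0:ℝ)..1, f x := by
  have := sum_sub_telescope (fun y => ∫ x in (0:ℝ)..y, f x) pt
  rw [hpt.1, hpt.2.1, intervalIntegral.integral_same, sub_zero] at this
  rw [← this]
  exact Finset.sum_congr rfl fun j _ => (intervalIntegral.integral_interval_sub_left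
    (hf.intervalIntegrable _ _) (hf.intervalIntegrable _ _)).symm

/-- Cauchy–Schwarz inequality for the pairing of a piecewise continuous function with a
piecewise polynomial. -/
theorem IsMesh.abs_ipF_le {pt : Fin (N+1) → ℝ} (hpt : IsMesh pt) {w : Fin N → ℝ → ℝ}
    (hw : ∀ j, Continuous (w j)) (v : Fin N → ℝ[X]) {K : ℝ} (hK : 0 ≤ K)
    (hwK : ∑ j : Fin N, ∫ x in (ptL pt j)..(ptR pt j), w j x ^ 2 ≤ K ^ 2) :
    |ipF pt w v| ≤ K * l2 pt v := by
  have hquad : ∀ t : ℝ, 0 ≤ ip pt v v * (t * t) + (2 * ipF pt w v) * t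
      + ∑ j : Fin N, ∫ x in (ptL pt j)..(ptR pt j), w j x ^ 2 := by
    intro t
    have h0 : 0 ≤ ∑ j : Fin N, ∫ x in (ptL pt j)..(ptR pt j), (t * (v j).eval x + w j x) ^ 2 :=
      Finset.sum_nonneg fun j _ =>
        intervalIntegral.integral_nonneg (hpt.ptL_lt_ptR j).le fun x _ => sq_nonneg _
    refine h0.trans_eq ?_
    simp only [ip, ipF, cip, Finset.mul_sum, Finset.sum_mul, ← Finset.sum_add_distrib]
    refine Finset.sum_congr rfl fun j _ => ?_
    have hwj := hw j
    rw [← intervalIntegral.integral_const_mul, ← intervalIntegral.integral_mul_const,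
      ← intervalIntegral.integral_mul_const,
      ← intervalIntegral.integral_add (Continuous.intervalIntegrable (by fun_prop) _ _)
        (Continuous.intervalIntegrable (by fun_prop) _ _),
      ← intervalIntegral.integral_add (Continuous.intervalIntegrable (by fun_prop) _ _)
        (Continuous.intervalIntegrable (by fun_prop) _ _)]
    congr 1
    funext x
    ring
  have hv0 : 0 ≤ ip pt v v := Finset.sum_nonneg fun j _ =>
    intervalIntegral.integral_nonneg (hpt.ptL_lt_ptR j).le fun x _ => mul_self_nonneg _
  have hdisc := discrim_le_zero hquad
  rw [discrim] at hdisc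
  have hmul := mul_le_mul_of_nonneg_left hwK hv0
  refine abs_le_of_sq_le_sq ?_ (mul_nonneg hK (Real.sqrt_nonneg _))
  rw [mul_pow, l2, Real.sq_sqrt hv0]
  linarith

section Eta

variable {k s : ℕ} {c d : ℕ → ℕ → ℝ} {β : ℝ} {u : ℝ → ℝ → ℝ} {pt : Fin (N+1) → ℝ}
  {Pstar : (ℝ → ℝ) → Fin N → ℝ[X]} {τ : ℝ}

/-- By the choice of projection, the projection errors do not contribute to the DG form. -/
theorem HformF_etaDcomb [NeZero N] (hu : IsSmoothSolution β u) (hτ : τ ∈ Set.Ioc (0 : ℝ) 1)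
    (hP : ∀ W : ℝ → ℝ, Continuous W → ∀ j,
      IsGRProj k (ptL pt j) (ptR pt j) W (Pstar W j))
    (n ℓ : ℕ) {v : Fin N → ℝ[X]} (hv : MemVk k v) :
    HformF pt β (etaDcomb Pstar u c d β τ s n ℓ) v = 0 := by
  have hcont := fun m => continuous_UrefS c d hu hτ s n m
  have hproj : ∀ j, IsGRProj k (ptL pt j) (ptR pt j)
      (fun x => ∑ m ∈ Finset.range (ℓ + 1), d ℓ m * UrefS u c d β τ s n m x)
      (∑ m ∈ Finset.range (ℓ + 1), C (d ℓ m) * Pstar (UrefS u c d β τ s n m) j) := fun j =>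
    IsGRProj.sum _ (fun m => continuous_const.mul (hcont m))
      fun m => (hP _ (hcont m) j).const_mul _
  have heq : ∀ j x, etaDcomb Pstar u c d β τ s n ℓ j x =
      ∑ m ∈ Finset.range (ℓ + 1), d ℓ m * UrefS u c d β τ s n m x -
      (∑ m ∈ Finset.range (ℓ + 1), C (d ℓ m) * Pstar (UrefS u c d β τ s n m) j).eval x := by
    intro j x
    simp only [etaDcomb, etaRef, eval_finsetSum, eval_mul, eval_C, mul_sub,
      Finset.sum_sub_distrib]
  simp only [HformF, heq, (hproj _).integral_mul_derivative (hv _), (hproj _).2.2, sub_self,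
    zero_mul, Finset.sum_const_zero, mul_zero, add_zero]

theorem abs_ipF_etaCcomb_le (hpt : IsMesh pt) (hu : IsSmoothSolution β u)
    (hτ : τ ∈ Set.Ioc (0 : ℝ) 1)
    (hP : ∀ W : ℝ → ℝ, Continuous W → ∀ j,
      IsGRProj k (ptL pt j) (ptR pt j) W (Pstar W j))
    {n ℓ : ℕ} {G : ℝ → ℝ} (hGdef : G = fun x => τ⁻¹ * (UrefS u c d β τ s n (ℓ + 1) x
        + (-1) * ∑ m ∈ Finset.range (ℓ + 1), c ℓ m * UrefS u c d β τ s n m x))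
    (hG : ContDiff ℝ (⊤ : ℕ∞) G) {M : ℝ} (hM : ∀ x, |iteratedDeriv (k + 1) G x| ≤ M)
    (v : Fin N → ℝ[X]) :
    |ipF pt (etaCcomb Pstar u c d β τ s n ℓ) v| ≤ 2 * M * meshSize pt ^ (k + 1) * l2 pt v := by
  have hM0 : 0 ≤ M := (abs_nonneg _).trans (hM 0)
  have hcont := fun m => continuous_UrefS c d hu hτ s n m
  have hsum : Continuous fun x =>
      ∑ m ∈ Finset.range (ℓ + 1), c ℓ m * UrefS u c d β τ s n m x :=
    continuous_finsetSum _ fun m _ => continuous_const.mul (hcont m)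
  set p : Fin N → ℝ[X] := fun j => C τ⁻¹ * (Pstar (UrefS u c d β τ s n (ℓ + 1)) j
    + C (-1) * ∑ m ∈ Finset.range (ℓ + 1), C (c ℓ m) * Pstar (UrefS u c d β τ s n m) j)
    with hp
  have hproj : ∀ j, IsGRProj k (ptL pt j) (ptR pt j) G (p j) := fun j => by
    rw [hGdef]
    exact ((hP _ (hcont _) j).add (hcont _) (continuous_const.mul hsum)
      ((IsGRProj.sum _ (fun m => continuous_const.mul (hcont m))
        fun m => (hP _ (hcont m) j).const_mul _).const_mul _)).const_mul _
  have heq : etaCcomb Pstar u c d β τ s n ℓ = fun j x => G x - (p j).eval x := by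
    funext j x
    simp only [etaCcomb, etaRef, hGdef, hp, eval_finsetSum, eval_mul, eval_add, eval_C,
      mul_sub, Finset.sum_sub_distrib]
    ring
  rw [heq]
  have hcell : ∀ j, 0 ≤ cellh pt j := fun j => (sub_pos.2 (hpt.ptL_lt_ptR j)).le
  have hmesh : 0 ≤ meshSize pt := Real.iSup_nonneg hcell
  refine hpt.abs_ipF_le (fun j => hG.continuous.sub (p j).continuous) v (by positivity) ?_
  calc ∑ j : Fin N, ∫ x in (ptL pt j)..(ptR pt j), (G x - (p j).eval x) ^ 2
      ≤ ∑ j : Fin N, 4 * M ^ 2 * meshSize pt ^ (2 * (k + 1)) * cellh pt j := by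
        refine Finset.sum_le_sum fun j _ =>
          ((hproj j).integral_sq_sub_le (hpt.ptL_lt_ptR j).le hG hM).trans ?_
        change 4 * M ^ 2 * cellh pt j ^ (2 * (k + 1)) * cellh pt j ≤ _
        have h1 := hcell j
        have h2 := cellh_le_meshSize pt j
        gcongr
    _ = (2 * M * meshSize pt ^ (k + 1)) ^ 2 := by
        rw [← Finset.mul_sum, hpt.sum_cellh]; ring

theorem abs_ipF_rhoRef_le (hpt : IsMesh pt) (hu : IsSmoothSolution β u)
    (hτ : τ ∈ Set.Ioc (0 : ℝ) 1) {n ℓ : ℕ} {K : ℝ} (hK : 0 ≤ K)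
    (hρ : fl2 (rkRes u c d β τ s n) ≤ K) (v : Fin N → ℝ[X]) :
    |ipF pt (fun _ => rhoRef u c d β τ s n ℓ) v| ≤ K * l2 pt v := by
  have hcont := continuous_rhoRef c d hu hτ s n ℓ
  refine hpt.abs_ipF_le (fun _ => hcont) v hK ?_
  rw [hpt.sum_integral (f := fun x => rhoRef u c d β τ s n ℓ x ^ 2) (hcont.pow 2)]
  by_cases h : ℓ = s - 1
  · simp only [rhoRef, if_pos h]
    exact (Real.sqrt_le_left hK).1 hρ
  · simp only [rhoRef, if_neg h]
    simpa using sq_nonneg K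

end Eta

/-- Lemma 4.3, 1D case.  With
`Z^{n,ℓ}(v) = ∫_Ω η_c^{n,ℓ} v dx - H(η_d^{n,ℓ}, v) - ∫_Ω ρ^{n,ℓ} v dx`, there is a
constant `C` independent of `h`, `τ`, `n` with `‖Z^{n,ℓ}‖ ≤ C (h^{k+1} + τ^r)`,
i.e. `|Z^{n,ℓ}(v)| ≤ C (h^{k+1} + τ^r) ‖v‖_{L²(Ω)}` for all `v ∈ V^k`, `0 ≤ ℓ ≤ s-1`. -/
theorem Z_estimate
    (k s r : ℕ) (hs : 1 ≤ s)
    (c d : ℕ → ℕ → ℝ) (hc : ∀ ℓ < s, ∑ m ∈ Finset.range (ℓ+1), c ℓ m = 1)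
    (β γ Cr : ℝ) (hβ : 0 < β) (hγ : 1 ≤ γ) (hCr : 0 ≤ Cr)
    (u : ℝ → ℝ → ℝ) (hu : IsSmoothSolution β u) :
    ∃ C : ℝ, 0 < C ∧
      ∀ (N : ℕ) [NeZero N] (pt : Fin (N+1) → ℝ),
        IsMesh pt → QuasiUniform pt γ → meshSize pt ≤ 1 →
      ∀ τ : ℝ, 0 < τ → τ ≤ 1 →
      ∀ n : ℕ, fl2 (rkRes u c d β τ s n) ≤ Cr * τ ^ r →
      ∀ Pstar : (ℝ → ℝ) → Fin N → Polynomial ℝ,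
        (∀ W : ℝ → ℝ, Continuous W → ∀ j,
          IsGRProj k (ptL pt j) (ptR pt j) W (Pstar W j)) →
      ∀ ℓ < s, ∀ v : Fin N → Polynomial ℝ, MemVk k v →
        |ipF pt (etaCcomb Pstar u c d β τ s n ℓ) v
          - HformF pt β (etaDcomb Pstar u c d β τ s n ℓ) v
          - ipF pt (fun _ => rhoRef u c d β τ s n ℓ) v|
        ≤ C * (meshSize pt ^ (k+1) + τ ^ r) * l2 pt v := by
  have hunif := fun (ℓ : ℕ) (hℓ : ℓ < s) =>
    (unifSmooth_UrefS_comb (d := d) hc hu hℓ).2 (k + 1)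
  choose! M hM using hunif
  have hM0 : ∀ ℓ < s, 0 ≤ M ℓ := fun ℓ hℓ =>
    (abs_nonneg _).trans (hM ℓ hℓ (⟨1, one_pos, le_rfl⟩, 0) 0)
  set M' := ∑ ℓ ∈ Finset.range s, M ℓ with hM'
  have hM'0 : 0 ≤ M' := Finset.sum_nonneg fun ℓ hℓ => hM0 ℓ (Finset.mem_range.1 hℓ)
  refine ⟨2 * M' + Cr + 1, by positivity, ?_⟩
  intro N _ pt hpt _ _ τ hτ0 hτ1 n hρ Pstar hP ℓ hℓ v hv
  have hτ : τ ∈ Set.Ioc (0 : ℝ) 1 := ⟨hτ0, hτ1⟩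
  have hMle : M ℓ ≤ M' := Finset.single_le_sum
    (fun i hi => hM0 i (Finset.mem_range.1 hi)) (Finset.mem_range.2 hℓ)
  have h1 := abs_ipF_etaCcomb_le hpt hu hτ hP rfl
    ((unifSmooth_UrefS_comb (d := d) hc hu hℓ).1 (⟨τ, hτ⟩, n)) (M := M')
    (fun x => (hM ℓ hℓ (⟨τ, hτ⟩, n) x).trans hMle) v
  have h2 := abs_ipF_rhoRef_le (ℓ := ℓ) hpt hu hτ (by positivity) hρ v
  rw [HformF_etaDcomb hu hτ hP n ℓ hv, sub_zero]
  have hmesh : 0 ≤ meshSize pt :=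
    Real.iSup_nonneg fun j => (sub_pos.2 (hpt.ptL_lt_ptR j)).le
  have hl2 : 0 ≤ l2 pt v := Real.sqrt_nonneg _
  have hA : 0 ≤ (Cr + 1) * meshSize pt ^ (k + 1) * l2 pt v := by positivity
  have hB : 0 ≤ (2 * M' + 1) * τ ^ r * l2 pt v := by positivity
  calc _ ≤ _ := abs_sub _ _
    _ ≤ 2 * M' * meshSize pt ^ (k + 1) * l2 pt v + Cr * τ ^ r * l2 pt v := add_le_add h1 h2
    _ ≤ _ := by linarith
end OEDG
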